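/- arXiv:1011.5566 — 3 statements merged into one kernel-verified Lean document; each statement's English description precedes it below -/
import Mathlib

section
/- Let C be a k-dimensional linear code in F_q^n with generator matrix G, and let X_A, B, E be pairwise disjoint sets with X_A ∪ B ∪ E = {1,…,n} and B, E nonempty. Suppose that for every u ∈ F_q^n with supp(u) ⊆ X_A and every family of scalars (α_i)_{i∈B} in F_q not all zero, the vector u + Σ_{i∈B} α_i e_i does not lie in C. Then for every x ∈ F_q^n and every assignment g : B → F_q, the number of vectors z ∈ F_q^n satisfying G zᵀ = G xᵀ, z_i = x_i for all i ∈ X_A, and z_i = g(i) for all i ∈ B, is exactly q^{|E| − rank(G_E)}; in particular this number is the same for every g. -/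
open Matrix

/-- A vector lies in the column space of `M` if it is annihilated by the left kernel of `M`. -/
theorem Matrix.exists_mulVec_eq_of_forall_vecMul_eq_zero {F m n : Type*} [Field F] [Fintype m]
    [Fintype n] (M : Matrix m n F) (v : m → F)
    (h : ∀ y : m → F, y ᵥ* M = 0 → y ⬝ᵥ v = 0) : ∃ w, M *ᵥ w = v := by
  classical
  by_contra hv
  have hmem : v ∉ LinearMap.range M.mulVecLin := by
    rintro ⟨w, hw⟩
    exact hv ⟨w, hw⟩
  obtain ⟨f, hfv, hf⟩ := Submodule.exists_le_ker_of_notMem hmem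
  obtain ⟨y, rfl⟩ := (dotProductEquiv F m).surjective f
  refine hfv (h y (dotProduct_eq_zero _ fun w => ?_))
  rw [← dotProduct_mulVec]
  exact hf ⟨w, rfl⟩

/-- Multiplying by a vector that vanishes off `E` only involves the columns indexed by `E`. -/
theorem Matrix.mulVec_eq_submatrix_mulVec_of_support {F m n : Type*} [NonUnitalNonAssocSemiring F]
    [Fintype n] (G : Matrix m n F) (E : Finset n) (v : n → F)
    (hv : ∀ i ∉ E, v i = 0) :
    G *ᵥ v = G.submatrix id (fun j : ↥E => (j : n)) *ᵥ fun j : ↥E => v j := by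
  ext a
  simp only [mulVec, dotProduct, submatrix_apply, id]
  rw [Finset.sum_coe_sort E (fun j => G a j * v j)]
  exact (Finset.sum_subset (Finset.subset_univ E) fun i _ hi => by simp [hv i hi]).symm

theorem Matrix.card_ker_mulVecLin {F m n : Type*} [Field F] [Fintype F] [Fintype m] [Fintype n]
    (M : Matrix m n F) :
    Nat.card (LinearMap.ker M.mulVecLin) = Fintype.card F ^ (Fintype.card n - M.rank) := by
  have h := LinearMap.finrank_range_add_finrank_ker M.mulVecLin
  rw [Module.finrank_fintype_fun_eq_card] at h
  rw [Module.natCard_eq_pow_finrank (K := F), Nat.card_eq_fintype_card]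
  congr 1
  rw [Matrix.rank]
  omega

/-- If the linear system has a solution `z₀` among the vectors agreeing with `z₀` off `E`, its
solutions are a translate of the kernel of the columns indexed by `E`. -/
theorem Matrix.card_mulVec_eq_of_eqOn_compl {F m n : Type*} [Field F] [Fintype F] [Fintype m]
    [Fintype n] (G : Matrix m n F) (E : Finset n) (z₀ : n → F) :
    Nat.card {z : n → F // G *ᵥ z = G *ᵥ z₀ ∧ ∀ i ∉ E, z i = z₀ i} =
      Fintype.card F ^ (E.card - (G.submatrix id (fun j : ↥E => (j : n))).rank) := by
  classical
  have hcard := (G.submatrix id (fun j : ↥E => (j : n))).card_ker_mulVecLin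
  rw [Fintype.card_coe] at hcard
  rw [← hcard]
  refine Nat.card_congr
    { toFun := fun z => ⟨fun j => z.1 j - z₀ j, ?_⟩
      invFun := fun w => ⟨fun i => z₀ i + if h : i ∈ E then w.1 ⟨i, h⟩ else 0, ?_, ?_⟩
      left_inv := ?_
      right_inv := ?_ }
  · have h := G.mulVec_eq_submatrix_mulVec_of_support E (z.1 - z₀)
      fun i hi => by simp [z.2.2 i hi]
    rw [mulVec_sub, z.2.1, sub_self] at h
    exact h.symm
  · have h := G.mulVec_eq_submatrix_mulVec_of_support E
      (fun i => if h : i ∈ E then w.1 ⟨i, h⟩ else 0) fun i hi => by simp [hi]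
    have hw : G.submatrix id (fun j : ↥E => (j : n)) *ᵥ w.1 = 0 := w.2
    simp only [Finset.coe_mem, dite_true, Subtype.coe_eta] at h
    change G *ᵥ (z₀ + fun i => if h : i ∈ E then w.1 ⟨i, h⟩ else 0) = G *ᵥ z₀
    rw [mulVec_add, h, hw, add_zero]
  · intro i hi
    simp [hi]
  · intro z
    ext i
    by_cases hi : i ∈ E
    · simp [hi]
    · simp [hi, z.2.2 i hi]
  · intro w
    ext j
    simp


/-- **Lemma 3 (forward direction, counting form).** Under the security condition,
for every `x` and every assignment `g` on `B`, the number of vectors `z` consistent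
with the broadcast `G xᵀ`, the side information on `X_A`, and taking the values `g`
on `B` is exactly `q ^ (|E| - rank G_E)`; in particular it does not depend on `g`. -/
theorem index_coding_card_consistent_completions
    {F : Type*} [Field F] [Fintype F] {n k : ℕ}
    (C : Submodule F (Fin n → F)) (G : Matrix (Fin k) (Fin n) F)
    (hindep : LinearIndependent F (fun i : Fin k => G i))
    (hspan : Submodule.span F (Set.range (fun i : Fin k => G i)) = C)
    (XA B E : Finset (Fin n))
    (hAB : Disjoint XA B) (hAE : Disjoint XA E) (hBE : Disjoint B E)
    (hcover : XA ∪ B ∪ E = Finset.univ)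
    (hB : B.Nonempty) (hE : E.Nonempty)
    (hsec : ∀ u α : Fin n → F, (∀ i, u i ≠ 0 → i ∈ XA) →
      (∀ i, α i ≠ 0 → i ∈ B) → α ≠ 0 → u + α ∉ C) :
    ∀ x g : Fin n → F,
      Nat.card {z : Fin n → F //
          G.mulVec z = G.mulVec x ∧ (∀ i ∈ XA, z i = x i) ∧ (∀ i ∈ B, z i = g i)} =
        Fintype.card F ^ (E.card - (G.submatrix id (fun j : ↥E => (j : Fin n))).rank) := by
  classical
  intro x g
  set M := G.submatrix id (fun j : ↥E => (j : Fin n)) with hM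
  have hmem : ∀ i, i ∉ E → i ∈ XA ∨ i ∈ B := fun i hi => by
    have h : i ∈ XA ∪ B ∪ E := hcover ▸ Finset.mem_univ i
    simpa [hi] using h
  have hvanish : ∀ y : Fin k → F, y ᵥ* M = 0 → ∀ i ∈ B, (y ᵥ* G) i = 0 := by
    intro y hy i hi
    by_contra hne
    have hyE : ∀ j ∈ E, (y ᵥ* G) j = 0 := fun j hj => congrFun hy ⟨j, hj⟩
    refine hsec (fun j => if j ∈ XA then (y ᵥ* G) j else 0)
      (fun j => if j ∈ B then (y ᵥ* G) j else 0) (fun j hj => ?_) (fun j hj => ?_) ?_ ?_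
    · by_contra h
      simp [h] at hj
    · by_contra h
      simp [h] at hj
    · exact fun h => hne (by simpa [hi] using congrFun h i)
    · have hsum : (fun j => if j ∈ XA then (y ᵥ* G) j else 0) +
          (fun j => if j ∈ B then (y ᵥ* G) j else 0) = y ᵥ* G := by
        ext j
        by_cases hjA : j ∈ XA
        · simp [hjA, Finset.disjoint_left.mp hAB hjA]
        · by_cases hjB : j ∈ B
          · simp [hjA, hjB]
          · have hjE : j ∈ E := by
              by_contra h
              exact (hmem j h).elim hjA hjB
            simp [hjA, hjB, hyE j hjE]
      rw [hsum, ← hspan, vecMul_eq_sum]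
      exact Submodule.sum_mem _ fun a _ =>
        Submodule.smul_mem _ _ (Submodule.subset_span ⟨a, rfl⟩)
  obtain ⟨w, hw⟩ := M.exists_mulVec_eq_of_forall_vecMul_eq_zero
    (G *ᵥ fun i => if i ∈ B then g i - x i else 0) fun y hy => by
      rw [dotProduct_mulVec]
      refine Finset.sum_eq_zero fun i _ => ?_
      by_cases hi : i ∈ B
      · simp [hvanish y hy i hi]
      · simp [hi]
  have hext := G.mulVec_eq_submatrix_mulVec_of_support E
    (fun i => if h : i ∈ E then w ⟨i, h⟩ else 0) fun i hi => by simp [hi]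
  simp only [Finset.coe_mem, dite_true, Subtype.coe_eta] at hext
  set z₀ : Fin n → F := x + (fun i => if i ∈ B then g i - x i else 0) -
    fun i => if h : i ∈ E then w ⟨i, h⟩ else 0 with hz₀
  have hGz₀ : G *ᵥ z₀ = G *ᵥ x := by
    rw [hz₀, mulVec_sub, mulVec_add, hext, ← hM, hw, add_sub_cancel_right]
  have hA : ∀ i ∈ XA, z₀ i = x i := fun i hi => by
    simp [hz₀, Finset.disjoint_left.mp hAB hi, Finset.disjoint_left.mp hAE hi]
  have hB' : ∀ i ∈ B, z₀ i = g i := fun i hi => by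
    simp [hz₀, hi, Finset.disjoint_left.mp hBE hi]
  rw [← G.card_mulVec_eq_of_eqOn_compl E z₀]
  refine Nat.card_congr (Equiv.subtypeEquivRight fun z => ?_)
  rw [hGz₀]
  refine and_congr_right fun _ => ⟨fun h i hi => ?_, fun h => ⟨fun i hi => ?_, fun i hi => ?_⟩⟩
  · rcases hmem i hi with hi | hi
    · rw [h.1 i hi, hA i hi]
    · rw [h.2 i hi, hB' i hi]
  · rw [h i (Finset.disjoint_left.mp hAE hi), hA i hi]
  · rw [h i (Finset.disjoint_left.mp hBE hi), hB' i hi]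
end

section
/- Let C be a k-dimensional linear code in F_q^n with generator matrix G, and let X_A and B be disjoint subsets of {1,…,n} with B nonempty. Suppose there exist a vector u ∈ F_q^n with supp(u) ⊆ X_A and scalars (α_i)_{i∈B} in F_q, not all zero, such that u + Σ_{i∈B} α_i e_i ∈ C. Then for every x ∈ F_q^n, the value Σ_{i∈B} α_i z_i is the same for all z ∈ F_q^n satisfying G zᵀ = G xᵀ and z_i = x_i for all i ∈ X_A; that is, a nontrivial linear combination of the coordinates of x on B is determined by G xᵀ and the coordinates of x on X_A. -/
/-- Two vectors with the same image under `G` have the same dot product with every vector in the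
row space of `G`. -/
theorem dotProduct_eq_of_mem_span_rows {R m n : Type*} [CommSemiring R] [Fintype n]
    {G : Matrix m n R} {x z c : n → R} (h : G.mulVec z = G.mulVec x)
    (hc : c ∈ Submodule.span R (Set.range fun i => G i)) :
    c ⬝ᵥ z = c ⬝ᵥ x := by
  induction hc using Submodule.span_induction with
  | mem _ hy =>
    obtain ⟨i, rfl⟩ := hy
    exact congrFun h i
  | zero => simp
  | add _ _ _ _ ha hb => rw [add_dotProduct, add_dotProduct, ha, hb]
  | smul _ _ _ ha => rw [smul_dotProduct, smul_dotProduct, ha]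

/-- **Lemma 3 (converse direction).** If some vector `u + ∑_{i ∈ B} α_i e_i` (with
`supp u ⊆ X_A`, the `α_i` not all zero) lies in `C`, then the nontrivial linear
combination `∑_{i ∈ B} α_i x_i` is determined by the broadcast `G xᵀ` and the
coordinates of `x` on `X_A`. -/
theorem index_coding_combination_determined
    {F : Type*} [Field F] [Fintype F] {n k : ℕ}
    (C : Submodule F (Fin n → F)) (G : Matrix (Fin k) (Fin n) F)
    (hindep : LinearIndependent F (fun i : Fin k => G i))
    (hspan : Submodule.span F (Set.range (fun i : Fin k => G i)) = C)
    (XA B : Finset (Fin n)) (hAB : Disjoint XA B) (hB : B.Nonempty)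
    (u α : Fin n → F)
    (hu : ∀ i, u i ≠ 0 → i ∈ XA)
    (hα : ∀ i, α i ≠ 0 → i ∈ B) (hα0 : α ≠ 0)
    (hC : u + α ∈ C) :
    ∀ x z : Fin n → F, G.mulVec z = G.mulVec x → (∀ i ∈ XA, z i = x i) →
      ∑ i ∈ B, α i * z i = ∑ i ∈ B, α i * x i := by
  intro x z hG hx
  subst hspan
  have hdot := dotProduct_eq_of_mem_span_rows hG hC
  have hu_dot : u ⬝ᵥ z = u ⬝ᵥ x := Finset.sum_congr rfl fun i _ => by
    by_cases hi : u i = 0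
    · simp [hi]
    · rw [hx i (hu i hi)]
  have hα_dot (y : Fin n → F) : ∑ i ∈ B, α i * y i = α ⬝ᵥ y :=
    Finset.sum_subset (Finset.subset_univ B) fun i _ hi => by
      rw [not_imp_comm.mp (hα i) hi, zero_mul]
  rw [add_dotProduct, add_dotProduct, hu_dot] at hdot
  rw [hα_dot, hα_dot, add_left_cancel hdot]
end

section
/- Let C be a k-dimensional linear code in F_q^n with generator matrix G, let X_A ⊆ {1,…,n}, and let i ∉ X_A. Then the adversary knowing G xᵀ and the coordinates x_ℓ for ℓ ∈ X_A has no information about x_i — formally, for every x ∈ F_q^n, each value g ∈ F_q is taken as the i-th coordinate by the same number of vectors z ∈ F_q^n satisfying G zᵀ = G xᵀ and z_ℓ = x_ℓ for all ℓ ∈ X_A — if and only if for every u ∈ F_q^n with supp(u) ⊆ X_A, u + e_i ∉ C. -/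
/-- If `e_i` is not, modulo vectors supported on `A`, in the row space of `G`, then the kernel of `G`
contains a vector vanishing on `A` with `i`-th coordinate `1`. -/
theorem exists_mulVec_eq_zero_of_forall_add_single_notMem
    {F ι κ : Type*} [Field F] [Fintype ι] [DecidableEq ι] (G : Matrix κ ι F)
    (A : Finset ι) (i : ι)
    (h : ∀ u : ι → F, (∀ j, u j ≠ 0 → j ∈ A) →
      u + Pi.single i 1 ∉ Submodule.span F (Set.range fun a => G a)) :
    ∃ w : ι → F, G.mulVec w = 0 ∧ (∀ l ∈ A, w l = 0) ∧ w i = 1 := by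
  set C := Submodule.span F (Set.range fun a => G a) with hC
  let S : Submodule F (ι → F) := Submodule.pi {j | j ∉ A} fun _ => ⊥
  have hnot : (Pi.single i 1 : ι → F) ∉ C ⊔ S := by
    intro hmem
    obtain ⟨c, hc, s, hs, hcs⟩ := Submodule.mem_sup.1 hmem
    refine h (-s) (fun j hj => ?_) ?_
    · by_contra hjA
      exact hj (by simpa using Submodule.mem_pi.1 hs j hjA)
    · rwa [← hcs, add_comm c s, neg_add_cancel_left]
  obtain ⟨f, hfi, hf⟩ := Submodule.exists_le_ker_of_notMem hnot
  have key (v : ι → F) : f v = ∑ j, v j * f (Pi.single j 1) := by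
    conv_lhs => rw [pi_eq_sum_univ' v]
    simp [map_sum]
  refine ⟨fun j => (f (Pi.single i 1))⁻¹ * f (Pi.single j 1), ?_, fun l hl => ?_, ?_⟩
  · ext a
    have ha : f (G a) = 0 := hf (Submodule.mem_sup_left (Submodule.subset_span ⟨a, rfl⟩))
    rw [key] at ha
    simp only [Matrix.mulVec, dotProduct, Pi.zero_apply, mul_left_comm _ (f (Pi.single i 1))⁻¹]
    rw [← Finset.mul_sum, ha, mul_zero]
  · have hl' : f (Pi.single l 1) = 0 := by
      refine hf (Submodule.mem_sup_right (Submodule.mem_pi.2 fun j hj => ?_))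
      have hne : j ≠ l := fun e => hj (e ▸ hl)
      simp [hne]
    simp [hl']
  · exact inv_mul_cancel₀ hfi

/-- A vector orthogonal to the rows of `G` is orthogonal to their span. -/
theorem dotProduct_eq_zero_of_mem_span_rows
    {F ι κ : Type*} [Field F] [Fintype ι] (G : Matrix κ ι F) {w v : ι → F}
    (hw : G.mulVec w = 0) (hv : v ∈ Submodule.span F (Set.range fun a => G a)) :
    v ⬝ᵥ w = 0 := by
  induction hv using Submodule.span_induction with
  | mem v hv => obtain ⟨a, rfl⟩ := hv; exact congrFun hw a
  | zero => simp
  | add u v _ _ hu hv => rw [add_dotProduct, hu, hv, add_zero]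
  | smul c v _ hv => rw [smul_dotProduct, hv, smul_zero]

/-- **Lemma 3 (single-coordinate / weak-security case).** The adversary knowing `G xᵀ`
and the coordinates of `x` on `X_A` has no information about `x i` (i.e. every value
`g ∈ F` occurs as the `i`-th coordinate of the same number of consistent message
vectors) if and only if no vector `u + e_i` with `supp u ⊆ X_A` lies in `C`. -/
theorem index_coding_weak_security_iff
    {F : Type*} [Field F] [Fintype F] {n k : ℕ}
    (C : Submodule F (Fin n → F)) (G : Matrix (Fin k) (Fin n) F)
    (hindep : LinearIndependent F (fun i : Fin k => G i))
    (hspan : Submodule.span F (Set.range (fun i : Fin k => G i)) = C)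
    (XA : Finset (Fin n)) (i : Fin n) (hi : i ∉ XA) :
    (∀ x : Fin n → F, ∃ N : ℕ, ∀ g : F,
        Nat.card {z : Fin n → F //
          G.mulVec z = G.mulVec x ∧ (∀ ℓ ∈ XA, z ℓ = x ℓ) ∧ z i = g} = N) ↔
    (∀ u : Fin n → F, (∀ j, u j ≠ 0 → j ∈ XA) → u + Pi.single i 1 ∉ C) := by
  subst hspan
  constructor
  · intro h u hu hmem
    obtain ⟨N, hN⟩ := h 0
    have hpos : 0 < Nat.card {z : Fin n → F //
        G.mulVec z = G.mulVec 0 ∧ (∀ ℓ ∈ XA, z ℓ = (0 : Fin n → F) ℓ) ∧ z i = 0} :=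
      Nat.card_pos_iff.2 ⟨⟨⟨0, by simp⟩⟩, inferInstance⟩
    rw [hN 0, ← hN 1] at hpos
    obtain ⟨⟨⟨w, hGw, hwA, hwi⟩⟩, _⟩ := Nat.card_pos_iff.1 hpos
    rw [Matrix.mulVec_zero] at hGw
    have h0 := dotProduct_eq_zero_of_mem_span_rows G hGw hmem
    have huw : u ⬝ᵥ w = 0 := Finset.sum_eq_zero fun j _ => by
      by_cases hj : u j = 0
      · simp [hj]
      · simp [hwA j (hu j hj)]
    simp [add_dotProduct, huw, hwi] at h0
  · intro h x
    obtain ⟨w, hGw, hwA, hwi⟩ := exists_mulVec_eq_zero_of_forall_add_single_notMem G XA i h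
    refine ⟨_, fun g => Nat.card_congr (β := {z : Fin n → F //
      G.mulVec z = G.mulVec x ∧ (∀ ℓ ∈ XA, z ℓ = x ℓ) ∧ z i = 0})
      ((Equiv.subRight (g • w)).subtypeEquiv fun z => ?_)⟩
    have hA : (∀ ℓ ∈ XA, (z - g • w) ℓ = x ℓ) ↔ ∀ ℓ ∈ XA, z ℓ = x ℓ :=
      forall₂_congr fun l hl => by simp [hwA l hl]
    rw [Equiv.subRight_apply, hA]
    simp [Matrix.mulVec_sub, Matrix.mulVec_smul, hGw, hwi, sub_eq_zero]
end
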